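/- Let L be a first-order language, M and N be L-structures, and α a type. Suppose M and N are nonempty and the cardinalities of M and of N are both at most the cardinality of α. Then M and N are isomorphic as L-structures if and only if there exist surjective maps u : α → M and w : α → N such that for every L-formula φ with free variables indexed by α, φ.Realize u ↔ φ.Realize w. -/

import Mathlib

open FirstOrder FirstOrder.Language Cardinal

universe u v

theorem exists_surjective_of_lift_mk_le {M : Type u} {α : Type v} [Nonempty M]
    (h : Cardinal.lift.{v} #M ≤ Cardinal.lift.{u} #α) : ∃ f : α → M, Function.Surjective f := by
  obtain ⟨e⟩ := Cardinal.lift_mk_le'.1 h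
  exact ⟨Function.invFun e, Function.invFun_surjective e.injective⟩

/-- Two structures enumerated by surjections realizing the same formulas are isomorphic. -/
theorem nonempty_equiv_of_realize_iff {L : FirstOrder.Language} {M N α : Type*}
    [L.Structure M] [L.Structure N] {a : α → M} {b : α → N}
    (ha : Function.Surjective a) (hb : Function.Surjective b)
    (hab : ∀ φ : L.Formula α, φ.Realize a ↔ φ.Realize b) : Nonempty (M ≃[L] N) := by
  have realize_eq_iff (s t : L.Term α) :
      s.realize a = t.realize a ↔ s.realize b = t.realize b := by
    simpa only [Formula.realize_equal] using hab (s.equal t)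
  have eq_iff (i j : α) : a i = a j ↔ b i = b j := realize_eq_iff (.var i) (.var j)
  let g : M → N := b ∘ Function.surjInv ha
  have hg (i : α) : g (a i) = b i := (eq_iff _ _).1 (Function.surjInv_eq ha (a i))
  have g_bijective : Function.Bijective g := by
    refine ⟨fun x y hxy => ?_, fun y => ?_⟩
    · obtain ⟨i, rfl⟩ := ha x
      obtain ⟨j, rfl⟩ := ha y
      rw [hg, hg] at hxy
      exact (eq_iff i j).2 hxy
    · obtain ⟨i, rfl⟩ := hb y
      exact ⟨a i, hg i⟩
  refine ⟨{ Equiv.ofBijective g g_bijective with map_fun' := ?_, map_rel' := ?_ }⟩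
  · intro n f x
    obtain ⟨i, rfl⟩ := ha.comp_left x
    obtain ⟨j, hj⟩ := ha (Structure.funMap f (a ∘ i))
    have hbj : b j = Structure.funMap f (b ∘ i) :=
      (realize_eq_iff (.var j) (.func f fun k => .var (i k))).1 hj
    have hgi : g ∘ a ∘ i = b ∘ i := funext fun k => hg (i k)
    change g (Structure.funMap f (a ∘ i)) = Structure.funMap f (g ∘ a ∘ i)
    rw [hgi, ← hj, hg, hbj]
  · intro n r x
    obtain ⟨i, rfl⟩ := ha.comp_left x
    have hgi : g ∘ a ∘ i = b ∘ i := funext fun k => hg (i k)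
    have hr := hab (r.formula fun k => .var (i k))
    rw [Formula.realize_rel, Formula.realize_rel] at hr
    change Structure.RelMap r (g ∘ a ∘ i) ↔ Structure.RelMap r (a ∘ i)
    rw [hgi]
    exact hr.symm

theorem stmt_5 {L : FirstOrder.Language} {M : Type u} {N : Type u} [L.Structure M] [L.Structure N]
    {α : Type v} [Nonempty M] [Nonempty N]
    (hM : Cardinal.lift.{v} #M ≤ Cardinal.lift.{u} #α)
    (hN : Cardinal.lift.{v} #N ≤ Cardinal.lift.{u} #α) :
    Nonempty (M ≃[L] N) ↔
      ∃ (u' : α → M) (w : α → N), Function.Surjective u' ∧ Function.Surjective w ∧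
        ∀ φ : L.Formula α, φ.Realize u' ↔ φ.Realize w := by
  constructor
  · rintro ⟨e⟩
    obtain ⟨a, ha⟩ := exists_surjective_of_lift_mk_le hM
    exact ⟨a, e ∘ a, ha, e.surjective.comp ha, fun φ => (StrongHomClass.realize_formula e φ).symm⟩
  · rintro ⟨a, b, ha, hb, hab⟩
    exact nonempty_equiv_of_realize_iff ha hb hab
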